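/- arXiv:2003.00688 — 2 statements merged into one kernel-verified Lean document; each statement's English description precedes it below -/
import Mathlib

section
/- Let m ≥ 1, let R_1, ..., R_m be real numbers, and let λ_min ≤ 1/m. Then the maximum of ∑_{e=1}^m λ_e R_e over all λ ∈ ℝ^m with ∑_{e=1}^m λ_e = 1 and λ_e ≥ λ_min for all e equals (1 − m·λ_min)·max_e R_e + λ_min·∑_{e=1}^m R_e. (Closed form of the Minimax-REx objective.) -/
/-- Closed form of the Minimax-REx objective: for `m ≥ 1` risks `R 1, ..., R m` and
`λ_min ≤ 1/m`, the maximum of `∑ e, λ e * R e` over weight vectors `λ` with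
`∑ e, λ e = 1` and `λ e ≥ λ_min` for all `e` equals
`(1 - m·λ_min) · max_e R e + λ_min · ∑ e, R e`. -/
theorem minimax_rex_closed_form (m : ℕ) (hm : 0 < m) (R : Fin m → ℝ)
    (lamMin : ℝ) (hlam : lamMin ≤ 1 / m) :
    IsGreatest
      {x : ℝ | ∃ lam : Fin m → ℝ,
        (∑ e, lam e) = 1 ∧ (∀ e, lamMin ≤ lam e) ∧ x = ∑ e, lam e * R e}
      ((1 - m * lamMin) * Finset.univ.sup' (Finset.univ_nonempty_iff.mpr ⟨⟨0, hm⟩⟩) R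
        + lamMin * ∑ e, R e) := by
  have hm' : (0 : ℝ) < m := by exact_mod_cast hm
  have hc : 0 ≤ 1 - m * lamMin := by
    rw [le_div_iff₀ hm'] at hlam
    linarith
  constructor
  · obtain ⟨i, -, hi⟩ := Finset.exists_mem_eq_sup' (Finset.univ_nonempty_iff.mpr ⟨⟨0, hm⟩⟩) R
    refine ⟨fun e => lamMin + if e = i then 1 - m * lamMin else 0, ?_, fun e => ?_, ?_⟩
    · simp [Finset.sum_add_distrib]
    · dsimp only
      split_ifs <;> linarith
    · rw [hi]
      simp [add_mul, Finset.sum_add_distrib, Finset.mul_sum, add_comm]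
  · rintro x ⟨lam, hsum, hge, rfl⟩
    set M := Finset.univ.sup' (Finset.univ_nonempty_iff.mpr ⟨⟨0, hm⟩⟩) R
    calc ∑ e, lam e * R e
        = ∑ e, (lam e - lamMin) * R e + lamMin * ∑ e, R e := by
          simp [sub_mul, Finset.sum_sub_distrib, Finset.mul_sum]
      _ ≤ ∑ e, (lam e - lamMin) * M + lamMin * ∑ e, R e := by
          gcongr with e
          · exact sub_nonneg.mpr (hge e)
          · exact Finset.le_sup' R (Finset.mem_univ e)
      _ = (1 - m * lamMin) * M + lamMin * ∑ e, R e := by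
          rw [← Finset.sum_mul, Finset.sum_sub_distrib, hsum]
          simp
end

section
/- Let E be a real inner product space, let S be a subset of the unit sphere {y ∈ E : ‖y‖ = 1}, and let x be a point of the unit sphere with x ∈ convexHull(S). Then x ∈ S. Consequently, a point of the unit sphere lies outside the convex hull of any set of unit vectors not containing it. (The claim of Appendix B, Figure 5: any point of a finite sample of distinct points on a hypersphere lies outside the convex hull of the other sample points, so generalization on the sphere requires extrapolation.) -/
/-- A point of the unit sphere of a real inner product space that lies in the convex
hull of a set `S` of unit vectors must itself belong to `S`; consequently, a point of
the unit sphere lies outside the convex hull of any set of unit vectors not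
containing it. -/
theorem sphere_mem_convexHull_of_unit_vectors
    {E : Type*} [NormedAddCommGroup E] [InnerProductSpace ℝ E]
    (S : Set E) (hS : S ⊆ {y : E | ‖y‖ = 1}) (x : E) (hx : ‖x‖ = 1) :
    (x ∈ convexHull ℝ S → x ∈ S) ∧ (x ∉ S → x ∉ convexHull ℝ S) := by
  have h : x ∉ S → x ∉ convexHull ℝ S := fun hxS hxc => by
    have hsub : S ⊆ {y : E | innerₗ E x y < 1} := fun y hy =>
      (inner_lt_one_iff_real_of_norm_eq_one hx (hS hy)).mpr fun hxy => hxS (hxy ▸ hy)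
    have hlt : inner ℝ x x < 1 :=
      convexHull_min hsub (convex_halfSpace_lt (innerₗ E x).isLinear 1) hxc
    simp [hx] at hlt
  exact ⟨fun hxc => by_contra fun hxS => h hxS hxc, h⟩
end
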